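/- There is a universal constant K > 0 such that for every n ≥ 1, if z is a random vector uniformly distributed on the sphere of radius √n in ℝⁿ (the push-forward under x ↦ √n·x of the normalized uniform measure σ^{n−1} on the unit sphere), then z is sub-Gaussian with ‖z‖_{ψ₂} ≤ K; that is, for every unit vector u ∈ ℝⁿ and every real q ≥ 1, (E|⟨z,u⟩|^q)^{1/q} ≤ K·√q. -/

import Mathlib

open MeasureTheory
open scoped BigOperators

/-- Euclidean (ℓ2) norm of a vector in ℝ^n. -/
noncomputable def l2norm {n : ℕ} (v : Fin n → ℝ) : ℝ := Real.sqrt (∑ i, (v i) ^ 2)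

/-- The wedge `W(S) = {r·x : x ∈ S, r ∈ [0,1]}`. -/
def wedge {n : ℕ} (S : Set (Fin n → ℝ)) : Set (Fin n → ℝ) :=
  {y | ∃ r ∈ Set.Icc (0 : ℝ) 1, ∃ x ∈ S, y = r • x}

/-- The normalized uniform spherical measure
`σ^{n-1}(S) = λ^n(W(S)) / λ^n(W(S^{n-1}))`. -/
noncomputable def sphMeasure (n : ℕ) (S : Set (Fin n → ℝ)) : ENNReal :=
  volume (wedge S) / volume (wedge {x : Fin n → ℝ | l2norm x = 1})

/-- The Euclidean unit ball is contained in the wedge of the unit sphere. -/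
lemma mem_wedge_sphere {n : ℕ} {u y : Fin n → ℝ} (hu : l2norm u = 1)
    (hy : ∑ i, y i ^ 2 ≤ 1) : y ∈ wedge {x : Fin n → ℝ | l2norm x = 1} := by
  have h0 : 0 ≤ ∑ i, y i ^ 2 := Finset.sum_nonneg fun i _ => sq_nonneg _
  rcases h0.eq_or_lt with h | h
  · refine ⟨0, by simp, u, hu, ?_⟩
    ext i
    have := (Finset.sum_eq_zero_iff_of_nonneg (fun i _ => sq_nonneg (y i))).1 h.symm i
      (Finset.mem_univ i)
    simpa using this
  · have hpos : 0 < l2norm y := Real.sqrt_pos.2 h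
    have hsq : l2norm y ^ 2 = ∑ i, y i ^ 2 := Real.sq_sqrt h0
    refine ⟨l2norm y, ⟨hpos.le, Real.sqrt_le_one.2 hy⟩, (l2norm y)⁻¹ • y, ?_, ?_⟩
    · change Real.sqrt _ = 1
      rw [Real.sqrt_eq_one]
      simp only [Pi.smul_apply, smul_eq_mul, mul_pow, ← Finset.mul_sum]
      rw [← hsq, ← mul_pow, inv_mul_cancel₀ hpos.ne', one_pow]
    · rw [smul_smul, mul_inv_cancel₀ hpos.ne', one_smul]

open scoped Pointwise in
/-- The wedge of a cap at height `t` lies in a Euclidean ball of radius `√(1 - 3t²/4)`, hence the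
cap has small measure. -/
lemma sphMeasure_cap_le {n : ℕ} {u : Fin n → ℝ} (hu : l2norm u = 1) {t : ℝ} (ht : 0 ≤ t) :
    sphMeasure n ({x | l2norm x = 1} ∩ {x | t ≤ ∑ i, x i * u i}) ≤
      ENNReal.ofReal (Real.exp (-(3 / 8) * (n * t ^ 2))) := by
  have hu2 : ∑ i, u i ^ 2 = 1 := Real.sqrt_eq_one.1 hu
  rcases Set.eq_empty_or_nonempty ({x : Fin n → ℝ | l2norm x = 1} ∩ {x | t ≤ ∑ i, x i * u i})
    with he | ⟨x₀, hx₀, hx₀t⟩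
  · rw [he]
    simp [sphMeasure, wedge]
  have ht1 : t ≤ 1 := by
    have hx2 : ∑ i, x₀ i ^ 2 = 1 := Real.sqrt_eq_one.1 hx₀
    have := Finset.sum_mul_sq_le_sq_mul_sq Finset.univ x₀ u
    rw [hx2, hu2] at this
    have h3 : t ≤ ∑ i, x₀ i * u i := hx₀t
    nlinarith
  have hρ2 : 0 < 1 - 3 / 4 * t ^ 2 := by nlinarith
  set ρ := Real.sqrt (1 - 3 / 4 * t ^ 2) with hρ
  have hρ0 : 0 < ρ := Real.sqrt_pos.2 hρ2
  have hρsq : ρ ^ 2 = 1 - 3 / 4 * t ^ 2 := Real.sq_sqrt hρ2.le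
  have hsub : wedge ({x | l2norm x = 1} ∩ {x | t ≤ ∑ i, x i * u i}) ⊆
      (fun y => (t / 2) • u + y) '' (ρ • wedge {x : Fin n → ℝ | l2norm x = 1}) := by
    rintro _ ⟨r, ⟨hr0, hr1⟩, x, ⟨hx, hxt⟩, rfl⟩
    have hx2 : ∑ i, x i ^ 2 = 1 := Real.sqrt_eq_one.1 hx
    have hxt' : t ≤ ∑ i, x i * u i := hxt
    refine ⟨r • x - (t / 2) • u, ?_, by simp⟩
    rw [Set.mem_smul_set_iff_inv_smul_mem₀ hρ0.ne']
    apply mem_wedge_sphere hu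
    have hexp : ∑ i, (r • x - (t / 2) • u) i ^ 2 =
        r ^ 2 - r * t * ∑ i, x i * u i + t ^ 2 / 4 := by
      have : ∀ i, (r • x - (t / 2) • u) i ^ 2 =
          r ^ 2 * x i ^ 2 - r * t * (x i * u i) + t ^ 2 / 4 * u i ^ 2 := by
        intro i
        simp only [Pi.sub_apply, Pi.smul_apply, smul_eq_mul]
        ring
      simp only [this, Finset.sum_add_distrib, Finset.sum_sub_distrib, ← Finset.mul_sum, hx2, hu2]
      ring
    have hle : ∑ i, (r • x - (t / 2) • u) i ^ 2 ≤ ρ ^ 2 := by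
      rw [hexp, hρsq]
      have h1 : r * t * t ≤ r * t * ∑ i, x i * u i :=
        mul_le_mul_of_nonneg_left hxt' (mul_nonneg hr0 ht)
      have h2 : 0 ≤ (1 - r) * (1 + r - t ^ 2) :=
        mul_nonneg (by linarith) (by nlinarith)
      nlinarith
    simp only [Pi.smul_apply _ (r • x - (t / 2) • u), smul_eq_mul, mul_pow, ← Finset.mul_sum]
    rw [inv_pow, inv_mul_le_iff₀ (by positivity), mul_one]
    exact hle
  refine ENNReal.div_le_of_le_mul ((measure_mono hsub).trans ?_)
  rw [Set.image_add_left, measure_preimage_add, Measure.addHaar_smul]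
  gcongr
  rw [Module.finrank_fin_fun, abs_of_pos (pow_pos hρ0 _)]
  have h1 : ρ ≤ Real.exp (-(3 / 8) * t ^ 2) := by
    rw [hρ, Real.sqrt_le_iff]
    refine ⟨(Real.exp_pos _).le, ?_⟩
    rw [← Real.exp_nat_mul]
    have := Real.add_one_le_exp (-(3 / 4) * t ^ 2)
    refine le_trans (by linarith) (this.trans_eq ?_)
    congr 1
    push_cast
    ring
  calc ρ ^ n ≤ Real.exp (-(3 / 8) * t ^ 2) ^ n := pow_le_pow_left₀ hρ0.le h1 n
    _ = _ := by rw [← Real.exp_nat_mul]; congr 1; ring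

/-- A Gaussian tail bound gives a bound on the square-exponential moment. -/
lemma lintegral_exp_sq_le_of_tail {Ω : Type*} [MeasurableSpace Ω] {μ : Measure Ω}
    [IsProbabilityMeasure μ] {Y : Ω → ℝ} (hY : Measurable Y)
    (htail : ∀ s, 0 ≤ s → μ {ω | s ≤ |Y ω|} ≤ ENNReal.ofReal (2 * Real.exp (-(3 / 8) * s ^ 2))) :
    ∫⁻ ω, ENNReal.ofReal (Real.exp (3 / 16 * Y ω ^ 2)) ∂μ ≤ 3 := by
  rw [lintegral_eq_lintegral_meas_le μ (Filter.Eventually.of_forall fun ω => (Real.exp_pos _).le)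
    (by fun_prop)]
  rw [← Set.Ioc_union_Ioi_eq_Ioi (zero_le_one' ℝ)]
  refine (lintegral_union_le _ _ _).trans ?_
  have h1 : ∫⁻ s in Set.Ioc (0 : ℝ) 1, μ {ω | s ≤ Real.exp (3 / 16 * Y ω ^ 2)} ≤ 1 := by
    calc _ ≤ ∫⁻ s in Set.Ioc (0 : ℝ) 1, 1 := lintegral_mono fun s => prob_le_one
      _ = 1 := by simp
  have h2 : ∫⁻ s in Set.Ioi (1 : ℝ), μ {ω | s ≤ Real.exp (3 / 16 * Y ω ^ 2)} ≤ 2 := by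
    calc _ ≤ ∫⁻ s in Set.Ioi (1 : ℝ), ENNReal.ofReal (2 * s ^ (-2 : ℝ)) := by
          refine setLIntegral_mono (by fun_prop) fun s hs => ?_
          have hs1 : (1 : ℝ) < s := hs
          have hlog : 0 ≤ Real.log s := Real.log_nonneg hs1.le
          refine (measure_mono fun ω hω => ?_).trans
            ((htail (Real.sqrt (16 / 3 * Real.log s)) (Real.sqrt_nonneg _)).trans_eq ?_)
          · have : s ≤ Real.exp (3 / 16 * Y ω ^ 2) := hω
            rw [← Real.log_le_iff_le_exp (by linarith)] at this
            change Real.sqrt _ ≤ |Y ω|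
            rw [← Real.sqrt_sq_eq_abs]
            exact Real.sqrt_le_sqrt (by linarith)
          · rw [Real.sq_sqrt (by positivity), Real.rpow_def_of_pos (by linarith)]
            congr 3
            ring
      _ = ENNReal.ofReal (∫ s in Set.Ioi (1 : ℝ), 2 * s ^ (-2 : ℝ)) := by
          rw [ofReal_integral_eq_lintegral_ofReal]
          · exact (integrableOn_Ioi_rpow_of_lt (by norm_num) one_pos).const_mul 2
          · filter_upwards [ae_restrict_mem measurableSet_Ioi] with s hs
            have hs1 : (1 : ℝ) < s := hs
            have : 0 < s := by linarith
            simp only [Pi.zero_apply]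
            positivity
      _ = 2 := by
          rw [integral_const_mul, integral_Ioi_rpow_of_lt (by norm_num) one_pos]
          norm_num
  exact (add_le_add h1 h2).trans_eq (by norm_num)

lemma abs_rpow_le_mul_exp_sq {q a : ℝ} (hq : 0 < q) (ha : 0 < a) (y : ℝ) :
    |y| ^ q ≤ (q / (2 * a)) ^ (q / 2) * Real.exp (a * y ^ 2) := by
  have hx : 2 * a * y ^ 2 / q ≤ Real.exp (2 * a * y ^ 2 / q) :=
    (by linarith : _ ≤ 2 * a * y ^ 2 / q + 1).trans (Real.add_one_le_exp _)
  have h := Real.rpow_le_rpow (by positivity) hx (by positivity : 0 ≤ q / 2)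
  rw [← Real.exp_mul] at h
  calc |y| ^ q = (|y| ^ (2 : ℝ)) ^ (q / 2) := by
        rw [← Real.rpow_mul (abs_nonneg y)]; congr 1; ring
    _ = (q / (2 * a) * (2 * a * y ^ 2 / q)) ^ (q / 2) := by
        congr 1
        rw [Real.rpow_two, sq_abs]
        field_simp
    _ = (q / (2 * a)) ^ (q / 2) * (2 * a * y ^ 2 / q) ^ (q / 2) :=
        Real.mul_rpow (by positivity) (by positivity)
    _ ≤ _ := by
        gcongr
        refine h.trans_eq ?_
        congr 1
        field_simp

/-- A Gaussian tail bound implies the sub-Gaussian growth of absolute moments. -/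
lemma moment_le_of_tail {Ω : Type*} [MeasurableSpace Ω] {μ : Measure Ω}
    [IsProbabilityMeasure μ] {Y : Ω → ℝ} (hY : Measurable Y)
    (htail : ∀ s, 0 ≤ s → μ {ω | s ≤ |Y ω|} ≤ ENNReal.ofReal (2 * Real.exp (-(3 / 8) * s ^ 2)))
    {q : ℝ} (hq : 1 ≤ q) :
    (∫ ω, |Y ω| ^ q ∂μ) ^ (1 / q) ≤ 3 * Real.sqrt (8 / 3) * Real.sqrt q := by
  have hq0 : 0 < q := by linarith
  have hC : 0 ≤ (8 / 3 * q) ^ (q / 2) := by positivity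
  have hint : ∫ ω, |Y ω| ^ q ∂μ ≤ (8 / 3 * q) ^ (q / 2) * 3 := by
    rw [integral_eq_lintegral_of_nonneg_ae (Filter.Eventually.of_forall fun ω => by positivity)
      (hY.abs.pow_const q).aestronglyMeasurable]
    refine ENNReal.toReal_le_of_le_ofReal (by positivity) ?_
    calc ∫⁻ ω, ENNReal.ofReal (|Y ω| ^ q) ∂μ
        ≤ ∫⁻ ω, ENNReal.ofReal ((8 / 3 * q) ^ (q / 2)) *
            ENNReal.ofReal (Real.exp (3 / 16 * Y ω ^ 2)) ∂μ := by
          refine lintegral_mono fun ω => ?_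
          rw [← ENNReal.ofReal_mul hC]
          refine ENNReal.ofReal_le_ofReal ?_
          refine (abs_rpow_le_mul_exp_sq hq0 (by norm_num : (0 : ℝ) < 3 / 16) (Y ω)).trans_eq ?_
          congr 2
          ring
      _ = ENNReal.ofReal ((8 / 3 * q) ^ (q / 2)) *
            ∫⁻ ω, ENNReal.ofReal (Real.exp (3 / 16 * Y ω ^ 2)) ∂μ :=
          lintegral_const_mul _ (by fun_prop)
      _ ≤ ENNReal.ofReal ((8 / 3 * q) ^ (q / 2)) * 3 := by
          gcongr
          exact lintegral_exp_sq_le_of_tail hY htail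
      _ = ENNReal.ofReal ((8 / 3 * q) ^ (q / 2) * 3) := by
          rw [ENNReal.ofReal_mul hC]
          norm_num
  calc (∫ ω, |Y ω| ^ q ∂μ) ^ (1 / q)
      ≤ ((8 / 3 * q) ^ (q / 2) * 3) ^ (1 / q) :=
        Real.rpow_le_rpow (integral_nonneg fun ω => by positivity) hint (by positivity)
    _ = Real.sqrt (8 / 3 * q) * 3 ^ (1 / q) := by
        rw [Real.mul_rpow hC (by norm_num), ← Real.rpow_mul (by positivity), Real.sqrt_eq_rpow]
        congr 2
        field_simp
    _ ≤ Real.sqrt (8 / 3 * q) * 3 := by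
        gcongr
        calc (3 : ℝ) ^ (1 / q) ≤ 3 ^ (1 : ℝ) :=
              Real.rpow_le_rpow_of_exponent_le (by norm_num) ((div_le_one hq0).2 hq)
          _ = 3 := Real.rpow_one 3
    _ = _ := by
        rw [Real.sqrt_mul (by norm_num)]
        ring

/-- There is a universal constant `K > 0` such that a random vector uniformly
distributed on the sphere of radius `√n` in ℝⁿ is sub-Gaussian with
`‖z‖_{ψ₂} ≤ K`: for every unit `u` and every `q ≥ 1`,
`(E|⟨z,u⟩|^q)^{1/q} ≤ K·√q`. -/
theorem stmt3 :
    ∃ K > (0 : ℝ),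
      ∀ n : ℕ, 1 ≤ n →
      ∀ (Ω : Type) (mΩ : MeasurableSpace Ω) (μ : Measure Ω), IsProbabilityMeasure μ →
      ∀ z : Ω → (Fin n → ℝ), Measurable z →
      (∀ A : Set (Fin n → ℝ), MeasurableSet A →
          μ (z ⁻¹' A) =
            sphMeasure n ({x | l2norm x = 1} ∩ {x | (Real.sqrt n) • x ∈ A})) →
      ∀ u : Fin n → ℝ, l2norm u = 1 →
        ∀ q : ℝ, 1 ≤ q →
          (∫ ω, |∑ i, z ω i * u i| ^ q ∂μ) ^ (1 / q) ≤ K * Real.sqrt q := by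
  refine ⟨3 * Real.sqrt (8 / 3), by positivity, ?_⟩
  intro n hn Ω mΩ μ hμ z hz hlaw u hu q hq
  have hn0 : (0 : ℝ) < n := by exact_mod_cast hn
  have honeside : ∀ v : Fin n → ℝ, l2norm v = 1 → ∀ s, 0 ≤ s →
      μ {ω | s ≤ ∑ i, z ω i * v i} ≤ ENNReal.ofReal (Real.exp (-(3 / 8) * s ^ 2)) := by
    intro v hv s hs
    have hA : MeasurableSet {x : Fin n → ℝ | s ≤ ∑ i, x i * v i} :=
      measurableSet_le measurable_const (by fun_prop)
    have hset : {x : Fin n → ℝ | Real.sqrt n • x ∈ {x : Fin n → ℝ | s ≤ ∑ i, x i * v i}} =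
        {x | s / Real.sqrt n ≤ ∑ i, x i * v i} := by
      ext x
      simp only [Set.mem_ofPred_eq, Pi.smul_apply, smul_eq_mul, mul_assoc, ← Finset.mul_sum]
      rw [div_le_iff₀' (Real.sqrt_pos.2 hn0)]
    have h := hlaw _ hA
    rw [hset] at h
    refine h.le.trans ((sphMeasure_cap_le hv (by positivity)).trans_eq ?_)
    rw [div_pow, Real.sq_sqrt hn0.le, mul_div_cancel₀ _ hn0.ne']
  refine moment_le_of_tail (by fun_prop) (fun s hs => ?_) hq
  have hneg : l2norm (-u) = 1 := by simpa [l2norm] using hu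
  calc μ {ω | s ≤ |∑ i, z ω i * u i|}
      ≤ μ ({ω | s ≤ ∑ i, z ω i * u i} ∪ {ω | s ≤ ∑ i, z ω i * (-u) i}) := by
        refine measure_mono fun ω hω => ?_
        simpa [le_abs] using hω
    _ ≤ _ := (measure_union_le _ _).trans
        (add_le_add (honeside u hu s hs) (honeside (-u) hneg s hs))
    _ = _ := by
        rw [← ENNReal.ofReal_add (Real.exp_pos _).le (Real.exp_pos _).le, two_mul]
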